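/- Let A, T1, T2 be ℝ-trees with A nonempty and complete, and let ι1 : A → T1 and ι2 : A → T2 be isometric embeddings. Define the gluing T1 ⊔_A T2 as the quotient of the disjoint union of T1 and T2 by the identifications ι1(a) ~ ι2(a) for all a ∈ A, equipped with the function d that restricts to d_{T1} on T1, restricts to d_{T2} on T2, and satisfies d(x, y) = inf_{a∈A} ( d_{T1}(x, ι1(a)) + d_{T2}(ι2(a), y) ) for x ∈ T1 and y ∈ T2. Then d is a metric on T1 ⊔_A T2, the natural maps from T1 and from T2 into T1 ⊔_A T2 are isometric embeddings, and (T1 ⊔_A T2, d) is an ℝ-tree. -/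

import Mathlib

/-- `s` is a geodesic segment joining `x` to `y`: the image of an isometric embedding of a
compact real interval, with endpoints `x` and `y`. -/
def IsGeodesicSegmentBetween {X : Type*} [MetricSpace X] (s : Set X) (x y : X) : Prop :=
  ∃ (γ : ℝ → X) (b : ℝ), 0 ≤ b ∧
    (∀ u ∈ Set.Icc (0 : ℝ) b, ∀ v ∈ Set.Icc (0 : ℝ) b, dist (γ u) (γ v) = |u - v|) ∧
    γ 0 = x ∧ γ b = y ∧ s = γ '' Set.Icc 0 b

/-- `s` is a geodesic segment. -/
def IsGeodesicSegment {X : Type*} [MetricSpace X] (s : Set X) : Prop :=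
  ∃ x y : X, IsGeodesicSegmentBetween s x y

/-- An ℝ-tree: any two points are joined by a unique geodesic segment, and if two geodesic
segments meet exactly in a common endpoint then their union is a geodesic segment. -/
def IsRTree (X : Type*) [MetricSpace X] : Prop :=
  (∀ x y : X, ∃! s : Set X, IsGeodesicSegmentBetween s x y) ∧
  (∀ (s t : Set X) (x y z : X), IsGeodesicSegmentBetween s x y →
    IsGeodesicSegmentBetween t y z → s ∩ t = {y} → IsGeodesicSegmentBetween (s ∪ t) x z)

/-- `X` is leafless: every geodesic segment is contained in a strictly larger geodesic segment
extending it beyond each endpoint. -/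
def Leafless (X : Type*) [MetricSpace X] : Prop :=
  ∀ (x y : X) (s : Set X), IsGeodesicSegmentBetween s x y →
    ∃ (x' y' : X) (s' : Set X), IsGeodesicSegmentBetween s' x' y' ∧ s ⊆ s' ∧
      0 < dist x' x ∧ 0 < dist y y' ∧ dist x' y' = dist x' x + dist x y + dist y y'

/-- A ray: the image of an isometric embedding of `[0, ∞)`. -/
def IsRay {X : Type*} [MetricSpace X] (R : Set X) : Prop :=
  ∃ γ : ℝ → X, (∀ u ∈ Set.Ici (0 : ℝ), ∀ v ∈ Set.Ici (0 : ℝ), dist (γ u) (γ v) = |u - v|) ∧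
    R = γ '' Set.Ici 0

/-- A ray starting at the point `x`. -/
def IsRayFrom {X : Type*} [MetricSpace X] (x : X) (R : Set X) : Prop :=
  ∃ γ : ℝ → X, (∀ u ∈ Set.Ici (0 : ℝ), ∀ v ∈ Set.Ici (0 : ℝ), dist (γ u) (γ v) = |u - v|) ∧
    γ 0 = x ∧ R = γ '' Set.Ici 0

/-- An end of `X`, regarded as the set of all rays equivalent to a given ray (two rays are
equivalent when their intersection is a ray). -/
def IsEnd {X : Type*} [MetricSpace X] (e : Set (Set X)) : Prop :=
  ∃ R : Set X, IsRay R ∧ e = {R' : Set X | IsRay R' ∧ IsRay (R' ∩ R)}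

/-- The action of a map on ends (as sets of rays), by pushing every ray forward. -/
def pushEnd {X Y : Type*} (φ : X → Y) (e : Set (Set X)) : Set (Set Y) :=
  (Set.image φ) '' e

/-- Two rays starting at `x` locally coincide: their intersection contains more than `x`. -/
def LocCoincide {X : Type*} [MetricSpace X] (x : X) (R R' : Set X) : Prop :=
  ∃ p, p ∈ R ∩ R' ∧ p ≠ x

/-- `x` is a branch point: the valency of `x` (number of directions at `x`, i.e. classes of
rays from `x` up to local coincidence) is at least `3`. -/
def IsBranchPoint {X : Type*} [MetricSpace X] (x : X) : Prop :=
  ∃ R₁ R₂ R₃ : Set X, IsRayFrom x R₁ ∧ IsRayFrom x R₂ ∧ IsRayFrom x R₃ ∧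
    ¬ LocCoincide x R₁ R₂ ∧ ¬ LocCoincide x R₁ R₃ ∧ ¬ LocCoincide x R₂ R₃

/-- `X` is locally finite: every point has finite valency, i.e. finitely many directions. -/
def LocallyFiniteTree (X : Type*) [MetricSpace X] : Prop :=
  ∀ x : X, ∃ (n : ℕ) (Rs : Fin n → Set X), (∀ i, IsRayFrom x (Rs i)) ∧
    ∀ R : Set X, IsRayFrom x R → ∃ i, LocCoincide x R (Rs i)

/-- `X` admits at least three ends. -/
def AtLeastThreeEnds (X : Type*) [MetricSpace X] : Prop :=
  ∃ e₁ e₂ e₃ : Set (Set X), IsEnd e₁ ∧ IsEnd e₂ ∧ IsEnd e₃ ∧ e₁ ≠ e₂ ∧ e₁ ≠ e₃ ∧ e₂ ≠ e₃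

/-- `fbar : X → Y` induces the map `f` on ends: every ray lying in an end `e` is sent to a
ray lying in the end `f e`. -/
def Induces {X Y : Type*} [MetricSpace X] [MetricSpace Y]
    (fbar : X → Y) (f : Set (Set X) → Set (Set Y)) : Prop :=
  ∀ e : Set (Set X), IsEnd e → ∀ R ∈ e, fbar '' R ∈ f e

/-- The identifications used to glue `T1` to `T2` along `A`: `ι1 a` is identified with
`ι2 a` for every `a : A`. -/
inductive GlueRel {A T1 T2 : Type*} (ι1 : A → T1) (ι2 : A → T2) : (T1 ⊕ T2) → (T1 ⊕ T2) → Prop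
  | mk (a : A) : GlueRel ι1 ι2 (Sum.inl (ι1 a)) (Sum.inr (ι2 a))

theorem continuousOn_of_dist_eq {X : Type*} [MetricSpace X] {γ : ℝ → X} {S : Set ℝ}
    (hγ : ∀ u ∈ S, ∀ v ∈ S, dist (γ u) (γ v) = |u - v|) : ContinuousOn γ S := by
  refine (LipschitzOnWith.of_dist_le_mul (K := 1) fun u hu v hv => ?_).continuousOn
  rw [hγ u hu v hv, NNReal.coe_one, one_mul, Real.dist_eq]

namespace IsGeodesicSegmentBetween

variable {X Y : Type*} [MetricSpace X] [MetricSpace Y] {s t : Set X} {x y z p : X}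

theorem image_Icc {γ : ℝ → X} {a b : ℝ} (hab : a ≤ b)
    (hγ : ∀ u ∈ Set.Icc a b, ∀ v ∈ Set.Icc a b, dist (γ u) (γ v) = |u - v|) :
    IsGeodesicSegmentBetween (γ '' Set.Icc a b) (γ a) (γ b) := by
  refine ⟨fun u => γ (u + a), b - a, by linarith, ?_, by simp, by simp, ?_⟩
  · rintro u ⟨hu, hu'⟩ v ⟨hv, hv'⟩
    rw [hγ _ ⟨by linarith, by linarith⟩ _ ⟨by linarith, by linarith⟩]
    congr 1
    ring
  · ext q
    constructor
    · rintro ⟨u, ⟨hu, hu'⟩, rfl⟩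
      exact ⟨u - a, ⟨by linarith, by linarith⟩, by simp⟩
    · rintro ⟨u, ⟨hu, hu'⟩, rfl⟩
      exact ⟨u + a, ⟨by linarith, by linarith⟩, rfl⟩

theorem symm (h : IsGeodesicSegmentBetween s x y) : IsGeodesicSegmentBetween s y x := by
  obtain ⟨γ, b, hb, hγ, rfl, rfl, rfl⟩ := h
  refine ⟨fun u => γ (b - u), b, hb, ?_, by simp, by simp, ?_⟩
  · rintro u ⟨hu, hu'⟩ v ⟨hv, hv'⟩
    rw [hγ _ ⟨by linarith, by linarith⟩ _ ⟨by linarith, by linarith⟩, abs_sub_comm]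
    congr 1
    ring
  · ext q
    constructor
    · rintro ⟨u, ⟨hu, hu'⟩, rfl⟩
      exact ⟨b - u, ⟨by linarith, by linarith⟩, by simp⟩
    · rintro ⟨u, ⟨hu, hu'⟩, rfl⟩
      exact ⟨b - u, ⟨by linarith, by linarith⟩, rfl⟩

theorem left_mem (h : IsGeodesicSegmentBetween s x y) : x ∈ s := by
  obtain ⟨γ, b, hb, hγ, rfl, rfl, rfl⟩ := h
  exact ⟨0, ⟨le_rfl, hb⟩, rfl⟩

theorem right_mem (h : IsGeodesicSegmentBetween s x y) : y ∈ s :=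
  h.symm.left_mem

theorem dist_add_dist (h : IsGeodesicSegmentBetween s x y) (hp : p ∈ s) :
    dist x p + dist p y = dist x y := by
  obtain ⟨γ, b, hb, hγ, rfl, rfl, rfl⟩ := h
  obtain ⟨u, ⟨hu, hu'⟩, rfl⟩ := hp
  rw [hγ 0 ⟨le_rfl, hb⟩ u ⟨hu, hu'⟩, hγ u ⟨hu, hu'⟩ b ⟨hb, le_rfl⟩,
    hγ 0 ⟨le_rfl, hb⟩ b ⟨hb, le_rfl⟩, abs_of_nonpos (by linarith), abs_of_nonpos (by linarith),
    abs_of_nonpos (by linarith)]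
  ring

theorem image (h : IsGeodesicSegmentBetween s x y) {f : X → Y} (hf : Isometry f) :
    IsGeodesicSegmentBetween (f '' s) (f x) (f y) := by
  obtain ⟨γ, b, hb, hγ, rfl, rfl, rfl⟩ := h
  refine ⟨f ∘ γ, b, hb, ?_, rfl, rfl, (Set.image_comp f γ _).symm⟩
  intro u hu v hv
  rw [Function.comp_apply, Function.comp_apply, hf.dist_eq, hγ u hu v hv]

theorem union (hs : IsGeodesicSegmentBetween s x y) (ht : IsGeodesicSegmentBetween t y z)
    (h : dist x z = dist x y + dist y z) : IsGeodesicSegmentBetween (s ∪ t) x z := by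
  obtain ⟨γ, b, hb, hγ, rfl, rfl, rfl⟩ := hs
  obtain ⟨δ, c, hc, hδ, hy, rfl, rfl⟩ := ht
  have hγ' (u v : ℝ) (hu : 0 ≤ u) (huv : u ≤ v) (hv : v ≤ b) : dist (γ u) (γ v) = v - u := by
    rw [hγ u ⟨hu, by linarith⟩ v ⟨by linarith, hv⟩, abs_of_nonpos (by linarith)]
    ring
  have hδ' (u v : ℝ) (hu : 0 ≤ u) (huv : u ≤ v) (hv : v ≤ c) : dist (δ u) (δ v) = v - u := by
    rw [hδ u ⟨hu, by linarith⟩ v ⟨by linarith, hv⟩, abs_of_nonpos (by linarith)]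
    ring
  rw [← hy, hδ' 0 c le_rfl hc le_rfl, hy, hγ' 0 b le_rfl hb le_rfl] at h
  set η : ℝ → X := fun u => if u ≤ b then γ u else δ (u - b)
  have η_left (u : ℝ) (hu : u ≤ b) : η u = γ u := if_pos hu
  have η_right (u : ℝ) (hu : b ≤ u) : η u = δ (u - b) := by
    rcases hu.eq_or_lt with rfl | hu
    · rw [η_left _ le_rfl, sub_self, hy]
    · exact if_neg hu.not_ge
  have key (u v : ℝ) (hu : 0 ≤ u) (huv : u ≤ v) (hv : v ≤ b + c) :
      dist (η u) (η v) = |u - v| := by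
    rw [abs_of_nonpos (by linarith)]
    rcases le_total v b with hvb | hvb
    · rw [η_left _ hvb, η_left _ (huv.trans hvb), hγ' u v hu huv hvb]
      ring
    rcases le_total b u with hub | hub
    · rw [η_right _ hvb, η_right _ hub, hδ' _ _ (by linarith) (by linarith) (by linarith)]
      ring
    · rw [η_right _ hvb, η_left _ hub]
      have e1 := hγ' u b hu hub le_rfl
      have e2 := hδ' 0 (v - b) le_rfl (by linarith) (by linarith)
      have e3 := hγ' 0 u le_rfl hu hub
      have e4 := hδ' (v - b) c (by linarith) (by linarith) le_rfl
      rw [hy] at e2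
      have t1 := dist_triangle (γ u) (γ b) (δ (v - b))
      have t2 := dist_triangle4 (γ 0) (γ u) (δ (v - b)) (δ c)
      linarith
  refine ⟨η, b + c, by linarith, ?_, η_left 0 hb, ?_, ?_⟩
  · rintro u ⟨hu, hu'⟩ v ⟨hv, hv'⟩
    rcases le_total u v with huv | huv
    · exact key u v hu huv hv'
    · rw [dist_comm, abs_sub_comm]
      exact key v u hv huv hu'
  · rw [η_right _ (by linarith)]
    simp
  · ext q
    constructor
    · rintro (⟨u, ⟨hu, hu'⟩, rfl⟩ | ⟨u, ⟨hu, hu'⟩, rfl⟩)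
      · exact ⟨u, ⟨hu, by linarith⟩, η_left u hu'⟩
      · refine ⟨u + b, ⟨by linarith, by linarith⟩, ?_⟩
        rw [η_right _ (by linarith), add_sub_cancel_right]
    · rintro ⟨u, ⟨hu, hu'⟩, rfl⟩
      rcases le_total u b with hub | hub
      · exact Or.inl ⟨u, ⟨hu, hub⟩, (η_left u hub).symm⟩
      · exact Or.inr ⟨u - b, ⟨by linarith, by linarith⟩, (η_right u hub).symm⟩

theorem mem_of_dist_add_dist (hX : ∀ x y : X, ∃! s : Set X, IsGeodesicSegmentBetween s x y)
    (hs : IsGeodesicSegmentBetween s x y) (hp : dist x y = dist x p + dist p y) : p ∈ s := by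
  obtain ⟨t₁, ht₁, -⟩ := hX x p
  obtain ⟨t₂, ht₂, -⟩ := hX p y
  rw [(hX x y).unique hs (ht₁.union ht₂ hp)]
  exact Or.inl ht₁.right_mem

end IsGeodesicSegmentBetween

/-- In an ℝ-tree every point has a projection to every geodesic segment. -/
theorem IsRTree.exists_mem_segment {X : Type*} [MetricSpace X] (hX : IsRTree X) {s : Set X}
    {x y : X} (hs : IsGeodesicSegmentBetween s x y) (z : X) :
    ∃ p ∈ s, dist z x = dist z p + dist p x ∧ dist z y = dist z p + dist p y := by
  obtain ⟨t, ht, -⟩ := hX.1 x z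
  have hs' := hs
  have ht' := ht
  obtain ⟨γ, b, hb, hγ, rfl, rfl, rfl⟩ := hs
  obtain ⟨δ, c, hc, hδ, h0, rfl, rfl⟩ := ht
  set I := Set.Icc (0 : ℝ) b ∩ Set.Icc 0 c
  have hIc : IsCompact I := isCompact_Icc.inter isCompact_Icc
  have hK : IsCompact (I ∩ (fun u => dist (γ u) (δ u)) ⁻¹' {0}) := by
    refine hIc.of_isClosed_subset ?_ Set.inter_subset_left
    refine ContinuousOn.preimage_isClosed_of_isClosed ?_ hIc.isClosed isClosed_singleton
    exact continuous_dist.comp_continuousOn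
      (((continuousOn_of_dist_eq hγ).mono Set.inter_subset_left).prodMk
        ((continuousOn_of_dist_eq hδ).mono Set.inter_subset_right))
  obtain ⟨u, ⟨⟨⟨hu, hub⟩, -, huc⟩, hγδ⟩, hmax⟩ := hK.exists_isGreatest
    ⟨0, ⟨⟨le_rfl, hb⟩, le_rfl, hc⟩, by simp [h0]⟩
  have hγδ : γ u = δ u := dist_eq_zero.1 hγδ
  refine ⟨γ u, ⟨u, ⟨hu, hub⟩, rfl⟩, ?_, ?_⟩
  · have := ht'.dist_add_dist (p := δ u) ⟨u, ⟨hu, huc⟩, rfl⟩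
    rw [hγδ, dist_comm _ (γ 0), ← this, dist_comm (δ u) (γ 0), dist_comm (δ u), add_comm]
  · have g1 := IsGeodesicSegmentBetween.image_Icc hub
      fun v hv w hw => hγ v ⟨hu.trans hv.1, hv.2⟩ w ⟨hu.trans hw.1, hw.2⟩
    have g2 := IsGeodesicSegmentBetween.image_Icc huc
      fun v hv w hw => hδ v ⟨hu.trans hv.1, hv.2⟩ w ⟨hu.trans hw.1, hw.2⟩
    rw [← hγδ] at g2
    refine ((hX.2 _ _ _ _ _ g2.symm g1 ?_).dist_add_dist (Or.inl g2.left_mem)).symm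
    refine Set.Subset.antisymm ?_ (Set.singleton_subset_iff.2 ⟨g2.left_mem, g1.left_mem⟩)
    rintro q ⟨⟨v, ⟨hv, hv'⟩, rfl⟩, ⟨w, ⟨hw, hw'⟩, hvw⟩⟩
    have e1 := hγ 0 ⟨le_rfl, hb⟩ w ⟨hu.trans hw, hw'⟩
    have e2 := hδ 0 ⟨le_rfl, hc⟩ v ⟨hu.trans hv, hv'⟩
    rw [h0, ← hvw, e1, abs_of_nonpos (by linarith), abs_of_nonpos (by linarith)] at e2
    obtain rfl : v = w := by linarith
    have : v ≤ u := hmax ⟨⟨⟨hu.trans hw, hw'⟩, hu.trans hv, hv'⟩, by simp [hvw]⟩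
    obtain rfl : v = u := le_antisymm this hv
    exact hvw.symm

/-- A metric space is an ℝ-tree as soon as any two points are joined by a geodesic segment to
which every point has a projection. -/
theorem IsRTree.of_exists_segment {X : Type*} [MetricSpace X]
    (hX : ∀ x y : X, ∃ s, IsGeodesicSegmentBetween s x y ∧ ∀ z, ∃ p ∈ s,
      dist z x = dist z p + dist p x ∧ dist z y = dist z p + dist p y) : IsRTree X := by
  have mem {x y : X} {s : Set X} (hs : ∀ z, ∃ p ∈ s,
      dist z x = dist z p + dist p x ∧ dist z y = dist z p + dist p y) {z : X}
      (hz : dist x z + dist z y = dist x y) : z ∈ s := by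
    obtain ⟨p, hp, h1, h2⟩ := hs z
    have := dist_triangle x p y
    have h0 : dist z p = 0 := by
      have := dist_nonneg (x := z) (y := p)
      rw [dist_comm p x] at h1
      rw [dist_comm z x] at h1
      linarith
    rwa [dist_eq_zero.1 h0]
  have uniq (x y : X) : ∃! s : Set X, IsGeodesicSegmentBetween s x y := by
    obtain ⟨s, hs, hproj⟩ := hX x y
    refine ⟨s, hs, fun t ht => Set.Subset.antisymm (fun q hq => mem hproj (ht.dist_add_dist hq)) ?_⟩
    obtain ⟨γ, b, hb, hγ, rfl, rfl, rfl⟩ := hs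
    obtain ⟨δ, c, hc, hδ, h0, h1, rfl⟩ := ht
    have hbc : b = c := by
      have e1 := hγ 0 ⟨le_rfl, hb⟩ b ⟨hb, le_rfl⟩
      have e2 := hδ 0 ⟨le_rfl, hc⟩ c ⟨hc, le_rfl⟩
      rw [h0, h1, e1, abs_of_nonpos (by linarith), abs_of_nonpos (by linarith)] at e2
      linarith
    subst hbc
    rintro q ⟨u, hu, rfl⟩
    refine ⟨u, hu, ?_⟩
    have hδu : δ u ∈ γ '' Set.Icc 0 b := by
      refine mem hproj ?_
      rw [← h0, ← h1]
      exact IsGeodesicSegmentBetween.dist_add_dist ⟨δ, b, hb, hδ, rfl, rfl, rfl⟩ ⟨u, hu, rfl⟩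
    obtain ⟨v, hv, hvu⟩ := hδu
    have e1 := hγ 0 ⟨le_rfl, hb⟩ v hv
    have e2 := hδ 0 ⟨le_rfl, hb⟩ u hu
    rw [h0, ← hvu, e1, abs_of_nonpos (by linarith [hv.1]), abs_of_nonpos (by linarith [hu.1])] at e2
    obtain rfl : v = u := by linarith
    exact hvu.symm
  refine ⟨uniq, fun s t x y z hs ht hst => hs.union ht ?_⟩
  obtain ⟨s', hs', hproj⟩ := hX x y
  obtain rfl := (uniq x y).unique hs hs'
  obtain ⟨p, hp, h1, h2⟩ := hproj z
  have hpt : p ∈ t := ht.symm.mem_of_dist_add_dist uniq h2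
  obtain rfl : p = y := by
    have : p ∈ s ∩ t := ⟨hp, hpt⟩
    rwa [hst] at this
  rw [dist_comm x z, h1, dist_comm z p, dist_comm p x, add_comm]

/-- Projection of a point of an ℝ-tree to a complete subtree. -/
theorem IsRTree.exists_gate {A T : Type*} [MetricSpace A] [MetricSpace T] [Nonempty A]
    [CompleteSpace A] (hA : IsRTree A) (hT : IsRTree T) {f : A → T} (hf : Isometry f) (x : T) :
    ∃ p : A, ∀ a, dist x (f a) = dist x (f p) + dist p a := by
  obtain ⟨a₀⟩ := ‹Nonempty A›
  obtain ⟨s, ⟨γ, b, hb, hγ, rfl, hγb, rfl⟩, -⟩ := hT.1 x (f a₀)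
  have hK : IsCompact (Set.Icc 0 b ∩ γ ⁻¹' Set.range f) :=
    isCompact_Icc.of_isClosed_subset ((continuousOn_of_dist_eq hγ).preimage_isClosed_of_isClosed
      isClosed_Icc hf.isClosedEmbedding.isClosed_range) Set.inter_subset_left
  obtain ⟨u, ⟨⟨hu, hub⟩, p, hp⟩, hmin⟩ := hK.exists_isLeast ⟨b, ⟨hb, le_rfl⟩, a₀, hγb.symm⟩
  refine ⟨p, fun a => ?_⟩
  obtain ⟨t, ht, -⟩ := hA.1 p a
  have g1 := IsGeodesicSegmentBetween.image_Icc hu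
    fun v hv w hw => hγ v ⟨hv.1, hv.2.trans hub⟩ w ⟨hw.1, hw.2.trans hub⟩
  have g2 := ht.image hf
  rw [← hp] at g1
  rw [← hf.dist_eq]
  refine ((hT.2 _ _ _ _ _ g1 g2 ?_).dist_add_dist (Or.inl g1.right_mem)).symm
  refine Set.Subset.antisymm ?_ (Set.singleton_subset_iff.2 ⟨g1.right_mem, g2.left_mem⟩)
  rintro q ⟨⟨v, ⟨hv, hv'⟩, rfl⟩, ⟨a', -, ha'⟩⟩
  have : u ≤ v := hmin ⟨⟨hv, hv'.trans hub⟩, a', ha'⟩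
  obtain rfl : v = u := le_antisymm hv' this
  exact hp.symm

section Cover

variable {X T T' : Type*} [MetricSpace X] [MetricSpace T] [MetricSpace T'] {j : T → X}
  {j' : T' → X}

theorem exists_segment_of_gates (hT : IsRTree T) (hj : Isometry j)
    (hgate : ∀ z : X, ∃ g : T, ∀ t, dist z (j t) = dist z (j g) + dist g t) (x y : T) :
    ∃ s, IsGeodesicSegmentBetween s (j x) (j y) ∧ ∀ z, ∃ p ∈ s,
      dist z (j x) = dist z p + dist p (j x) ∧ dist z (j y) = dist z p + dist p (j y) := by
  obtain ⟨s, hs, -⟩ := hT.1 x y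
  refine ⟨j '' s, hs.image hj, fun z => ?_⟩
  obtain ⟨g, hg⟩ := hgate z
  obtain ⟨p, hp, h1, h2⟩ := hT.exists_mem_segment hs g
  refine ⟨j p, ⟨p, hp, rfl⟩, ?_, ?_⟩ <;> rw [hg, hg p, hj.dist_eq] <;> linarith

theorem exists_segment_of_gates_of_cover (hT : IsRTree T) (hT' : IsRTree T') (hj : Isometry j)
    (hj' : Isometry j') (hcover : ∀ z, z ∈ Set.range j ∨ z ∈ Set.range j')
    (hgate : ∀ y : T', ∃ (g : T) (g' : T'), j g = j' g' ∧
      ∀ t, dist (j' y) (j t) = dist (j' y) (j g) + dist g t)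
    (hgate' : ∀ x : T, ∃ (h : T) (h' : T'), j h = j' h' ∧
      ∀ t, dist (j x) (j' t) = dist (j x) (j' h') + dist h' t) (x : T) (y : T') :
    ∃ s, IsGeodesicSegmentBetween s (j x) (j' y) ∧ ∀ z, ∃ p ∈ s,
      dist z (j x) = dist z p + dist p (j x) ∧ dist z (j' y) = dist z p + dist p (j' y) := by
  obtain ⟨g, g', hgg, hg⟩ := hgate y
  obtain ⟨s, hs, -⟩ := hT.1 x g
  obtain ⟨s', hs', -⟩ := hT'.1 g' y
  have hgs' := hs'.image hj'
  rw [← hgg] at hgs'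
  have hxy : dist (j x) (j' y) = dist (j x) (j g) + dist (j g) (j' y) := by
    rw [dist_comm, hg, dist_comm (j' y), hj.dist_eq, dist_comm g x, add_comm]
  refine ⟨j '' s ∪ j' '' s', (hs.image hj).union hgs' hxy, fun z => ?_⟩
  rcases hcover z with ⟨z, rfl⟩ | ⟨z, rfl⟩
  · obtain ⟨p, hp, h1, h2⟩ := hT.exists_mem_segment hs z
    refine ⟨j p, Or.inl ⟨p, hp, rfl⟩, by simpa only [hj.dist_eq] using h1, ?_⟩
    rw [dist_comm, hg, dist_comm _ (j' y), hg p, hj.dist_eq, dist_comm g, h2, dist_comm g p]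
    ring
  · obtain ⟨h, h', hhh, hh⟩ := hgate' x
    obtain ⟨r, hr, -⟩ := hT'.1 h' y
    obtain ⟨m, hm, h1, h2⟩ := hT'.exists_mem_segment hr z
    refine ⟨j' m, ?_, ?_, by simpa only [hj'.dist_eq] using h2⟩
    · have ehg : dist h' g' = dist h g := by rw [← hj'.dist_eq, ← hgg, ← hhh, hj.dist_eq]
      have exg : dist x g = dist x h + dist h g := by
        have := hh g'
        rw [← hgg, ← hhh, hj.dist_eq, hj.dist_eq, ehg] at this
        exact this
      have eyh : dist y h' = dist y g' + dist g' h' := by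
        have := hg h
        rw [hgg, hhh, hj'.dist_eq, hj'.dist_eq, dist_comm g h, ← ehg, dist_comm h'] at this
        exact this
      obtain ⟨r₁, hr₁, -⟩ := hT'.1 h' g'
      have hr' := (hT'.1 h' y).unique hr (hr₁.union hs' (by
        rw [dist_comm, eyh, dist_comm g' h', dist_comm y g', add_comm]))
      rw [hr'] at hm
      rcases hm with hm | hm
      · left
        have hm' := hr₁.dist_add_dist hm
        obtain ⟨k, k', hkk, hk⟩ := hgate m
        have k1 := hk h
        have k2 := hk g
        rw [← hj.dist_eq, hkk, hhh, hj'.dist_eq, hj'.dist_eq, hj'.dist_eq] at k1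
        rw [← hj.dist_eq, hkk, hgg, hj'.dist_eq, hj'.dist_eq, hj'.dist_eq] at k2
        have hmk : m = k' := by
          have t1 := dist_triangle h' k' g'
          have t2 := dist_nonneg (x := m) (y := k')
          rw [dist_comm m h', dist_comm k' h'] at k1
          exact dist_eq_zero.1 (by linarith)
        rw [hmk, ← hkk]
        refine ⟨k, hs.mem_of_dist_add_dist hT.1 ?_, rfl⟩
        rw [hmk, ← hj'.dist_eq, ← hj'.dist_eq k', ← hj'.dist_eq h' g', ← hkk, ← hhh, ← hgg,
          hj.dist_eq, hj.dist_eq, hj.dist_eq] at hm'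
        have t1 := dist_triangle x h k
        have t2 := dist_triangle x k g
        linarith
      · exact Or.inr ⟨m, hm, rfl⟩
    · rw [dist_comm, hh, dist_comm _ (j x), hh m, hj'.dist_eq, dist_comm h' z, h1, dist_comm h' m]
      ring

/-- A metric space covered by two ℝ-trees, each of which is gated with gates in the
intersection, is an ℝ-tree. -/
theorem IsRTree.of_gates_of_cover (hT : IsRTree T) (hT' : IsRTree T') (hj : Isometry j)
    (hj' : Isometry j') (hcover : ∀ z, z ∈ Set.range j ∨ z ∈ Set.range j')
    (hgate : ∀ y : T', ∃ (g : T) (g' : T'), j g = j' g' ∧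
      ∀ t, dist (j' y) (j t) = dist (j' y) (j g) + dist g t)
    (hgate' : ∀ x : T, ∃ (h : T) (h' : T'), j h = j' h' ∧
      ∀ t, dist (j x) (j' t) = dist (j x) (j' h') + dist h' t) : IsRTree X := by
  refine .of_exists_segment fun x y => ?_
  rcases hcover x with ⟨x, rfl⟩ | ⟨x, rfl⟩ <;> rcases hcover y with ⟨y, rfl⟩ | ⟨y, rfl⟩
  · refine exists_segment_of_gates hT hj (fun z => ?_) x y
    rcases hcover z with ⟨z, rfl⟩ | ⟨z, rfl⟩
    · exact ⟨z, fun t => by simp [hj.dist_eq]⟩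
    · obtain ⟨g, -, -, hg⟩ := hgate z
      exact ⟨g, hg⟩
  · exact exists_segment_of_gates_of_cover hT hT' hj hj' hcover hgate hgate' x y
  · obtain ⟨s, hs, hp⟩ :=
      exists_segment_of_gates_of_cover hT hT' hj hj' hcover hgate hgate' y x
    refine ⟨s, hs.symm, fun z => ?_⟩
    obtain ⟨p, hps, h1, h2⟩ := hp z
    exact ⟨p, hps, h2, h1⟩
  · refine exists_segment_of_gates hT' hj' (fun z => ?_) x y
    rcases hcover z with ⟨z, rfl⟩ | ⟨z, rfl⟩
    · obtain ⟨-, g, -, hg⟩ := hgate' z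
      exact ⟨g, hg⟩
    · exact ⟨z, fun t => by simp [hj'.dist_eq]⟩

end Cover

theorem glue_trees_along_subtree {A T1 T2 : Type*}
    [MetricSpace A] [MetricSpace T1] [MetricSpace T2] [Nonempty A] [CompleteSpace A]
    (hA : IsRTree A) (h1 : IsRTree T1) (h2 : IsRTree T2)
    (ι1 : A → T1) (ι2 : A → T2) (hι1 : Isometry ι1) (hι2 : Isometry ι2) :
    ∃ m : MetricSpace (Quot (GlueRel ι1 ι2)),
      letI := m
      (∀ x x' : T1,
        dist (Quot.mk (GlueRel ι1 ι2) (Sum.inl x)) (Quot.mk (GlueRel ι1 ι2) (Sum.inl x')) =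
          dist x x') ∧
      (∀ y y' : T2,
        dist (Quot.mk (GlueRel ι1 ι2) (Sum.inr y)) (Quot.mk (GlueRel ι1 ι2) (Sum.inr y')) =
          dist y y') ∧
      (∀ (x : T1) (y : T2),
        dist (Quot.mk (GlueRel ι1 ι2) (Sum.inl x)) (Quot.mk (GlueRel ι1 ι2) (Sum.inr y)) =
          ⨅ a : A, (dist x (ι1 a) + dist (ι2 a) y)) ∧
      IsRTree (Quot (GlueRel ι1 ι2)) := by
  choose p1 hp1 using hA.exists_gate h1 hι1
  choose p2 hp2 using hA.exists_gate h2 hι2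
  have bdd (x : T1) (y : T2) : BddBelow (Set.range fun a : A => dist x (ι1 a) + dist (ι2 a) y) :=
    ⟨0, by rintro _ ⟨a, rfl⟩; positivity⟩
  have inf_left (x : T1) (y : T2) : ⨅ a : A, (dist x (ι1 a) + dist (ι2 a) y) =
      dist x (ι1 (p1 x)) + dist (ι2 (p1 x)) y := by
    refine le_antisymm (ciInf_le (bdd x y) _) (le_ciInf fun a => ?_)
    have := dist_triangle (ι2 (p1 x)) (ι2 a) y
    rw [hι2.dist_eq] at this
    linarith [hp1 x a]
  have inf_right (x : T1) (y : T2) : ⨅ a : A, (dist x (ι1 a) + dist (ι2 a) y) =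
      dist x (ι1 (p2 y)) + dist (ι2 (p2 y)) y := by
    refine le_antisymm (ciInf_le (bdd x y) _) (le_ciInf fun a => ?_)
    have := dist_triangle x (ι1 a) (ι1 (p2 y))
    rw [hι1.dist_eq, dist_comm a] at this
    rw [dist_comm _ y, dist_comm _ y]
    linarith [hp2 y a]
  let F : Quot (GlueRel ι1 ι2) → Metric.GlueSpace hι1 hι2 :=
    Quot.lift (Sum.elim (Metric.toGlueL hι1 hι2) (Metric.toGlueR hι1 hι2)) (by
      rintro _ _ ⟨a⟩
      exact congrFun (Metric.toGlue_commute hι1 hι2) a)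
  have dist_LR (x : T1) (y : T2) : dist (Metric.toGlueL hι1 hι2 x) (Metric.toGlueR hι1 hι2 y) =
      ⨅ a : A, (dist x (ι1 a) + dist (ι2 a) y) := by
    simp only [dist_comm _ y]
    exact add_zero _
  have eq_of_LR (x : T1) (y : T2) (h : Metric.toGlueL hι1 hι2 x = Metric.toGlueR hι1 hι2 y) :
      Quot.mk (GlueRel ι1 ι2) (Sum.inl x) = Quot.mk (GlueRel ι1 ι2) (Sum.inr y) := by
    have h0 := dist_LR x y
    rw [h, dist_self, inf_left] at h0
    have e1 : x = ι1 (p1 x) := dist_le_zero.1 (by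
      linarith [dist_nonneg (x := ι2 (p1 x)) (y := y)])
    have e2 : ι2 (p1 x) = y := dist_le_zero.1 (by
      linarith [dist_nonneg (x := x) (y := ι1 (p1 x))])
    rw [e1, ← e2]
    exact Quot.sound ⟨_⟩
  have hF : Function.Injective F := by
    rintro ⟨x | x⟩ ⟨y | y⟩ h
    · exact congrArg (fun x => Quot.mk _ (Sum.inl x))
        ((Metric.toGlueL_isometry hι1 hι2).injective h)
    · exact eq_of_LR x y h
    · exact (eq_of_LR y x h.symm).symm
    · exact congrArg (fun x => Quot.mk _ (Sum.inr x))
        ((Metric.toGlueR_isometry hι1 hι2).injective h)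
  let m : MetricSpace (Quot (GlueRel ι1 ι2)) := MetricSpace.induced F hF inferInstance
  have isoL : Isometry fun x : T1 => Quot.mk (GlueRel ι1 ι2) (Sum.inl x) :=
    Isometry.of_dist_eq (Metric.toGlueL_isometry hι1 hι2).dist_eq
  have isoR : Isometry fun y : T2 => Quot.mk (GlueRel ι1 ι2) (Sum.inr y) :=
    Isometry.of_dist_eq (Metric.toGlueR_isometry hι1 hι2).dist_eq
  have dist_mk (x : T1) (y : T2) :
      dist (Quot.mk (GlueRel ι1 ι2) (Sum.inl x)) (Quot.mk (GlueRel ι1 ι2) (Sum.inr y)) =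
        ⨅ a : A, (dist x (ι1 a) + dist (ι2 a) y) := dist_LR x y
  have glue (a : A) : Quot.mk (GlueRel ι1 ι2) (Sum.inl (ι1 a)) =
      Quot.mk (GlueRel ι1 ι2) (Sum.inr (ι2 a)) := Quot.sound ⟨a⟩
  refine ⟨m, isoL.dist_eq, isoR.dist_eq, dist_mk,
    .of_gates_of_cover h1 h2 isoL isoR ?_ (fun y => ?_) (fun x => ?_)⟩
  · rintro ⟨x | y⟩
    · exact Or.inl ⟨x, rfl⟩
    · exact Or.inr ⟨y, rfl⟩
  · refine ⟨ι1 (p2 y), ι2 (p2 y), glue _, fun t => ?_⟩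
    rw [glue, isoR.dist_eq, dist_comm, dist_mk, inf_right, dist_comm t, dist_comm _ y, add_comm]
  · refine ⟨ι1 (p1 x), ι2 (p1 x), glue _, fun t => ?_⟩
    rw [← glue, isoL.dist_eq, dist_mk, inf_left]
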